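/- arXiv:2004.10592 — 4 statements merged into one kernel-verified Lean document; each statement's English description precedes it below -/
import Mathlib

section
/- Let {a_n, b_n, ⟨,⟩_n, r^n_m, c^n_m} be a collection of data satisfying axioms (Γ-1)–(Γ-4) of a Γ-system. Let b⁰_n = ker(b_n → lim→ b_m) (direct limit along r^n_m) and let a¹_n ⊆ a_n be the annihilator of b⁰_n with respect to the perfect pairing ⟨,⟩_n. Then (i) r^n_m(b⁰_m) ⊆ b⁰_n and c^n_m(a¹_n) ⊆ a¹_m, so that the quotients b_n/b⁰_n form an inductive system along the maps induced by r^n_m and the a¹_n form a projective system along the maps induced by c^n_m, and (ii) the pairings ⟨,⟩_n induce a group isomorphism between Hom(lim→ (b_n/b⁰_n), ℚ_p/ℤ_p) and a¹ := lim← a¹_n; that is, lim→ (b_n/b⁰_n) ≅ (a¹)^∨, where (−)^∨ denotes Hom(−, ℚ_p/ℤ_p). -/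
open scoped BigOperators

noncomputable section

/-- The group `ℚ_p/ℤ_p`, realized as the quotient of the additive group of `ℚ_p`
by the image of `ℤ_p`. -/
abbrev QpZp (p : ℕ) [Fact p.Prime] : Type :=
  ℚ_[p] ⧸ ((PadicInt.Coe.ringHom (p := p)).toAddMonoidHom.range)

/-- The subgroup of `k`-th powers of a commutative group `Γ`. -/
def powSubgroup (Γ : Type) [CommGroup Γ] (k : ℕ) : Subgroup Γ :=
  (powMonoidHom k : Γ →* Γ).range

/-- A collection of data satisfying the axioms (Γ-1)–(Γ-4) of a `Γ`-system in the sense of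
Lai–Longhi–Tan–Trihan: finite `ℤ_p`-modules `a n`, `b n` with `Γ`-actions on which
`Γ^{p^n}` acts trivially, transition maps `r`, `c` forming inductive/projective systems,
the norm relations, and perfect `Γ`-compatible pairings into `ℚ_p/ℤ_p`. -/
structure GammaSystem (p : ℕ) [Fact p.Prime] (d : ℕ) : Type 1 where
  Γ : Type
  [instΓ : CommGroup Γ]
  gammaIso : Γ ≃* Multiplicative (Fin d → ℤ_[p])
  a : ℕ → Type
  b : ℕ → Type
  [instA : ∀ n, AddCommGroup (a n)]
  [instB : ∀ n, AddCommGroup (b n)]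
  [modA : ∀ n, Module ℤ_[p] (a n)]
  [modB : ∀ n, Module ℤ_[p] (b n)]
  finA : ∀ n, Finite (a n)
  finB : ∀ n, Finite (b n)
  /-- the `Γ`-action on `a n`, by `ℤ_p`-linear automorphisms -/
  ρa : ∀ n, Γ →* (a n ≃ₗ[ℤ_[p]] a n)
  ρb : ∀ n, Γ →* (b n ≃ₗ[ℤ_[p]] b n)
  /-- (Γ-1): `Γ^{p^n}` acts trivially on `a n` -/
  triv_a : ∀ n : ℕ, ∀ γ ∈ powSubgroup Γ (p ^ n), ρa n γ = 1
  triv_b : ∀ n : ℕ, ∀ γ ∈ powSubgroup Γ (p ^ n), ρb n γ = 1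
  /-- the maps `r^n_m` (on the `a`-component) -/
  ra : ∀ {m n : ℕ}, m ≤ n → a m →ₗ[ℤ_[p]] a n
  rb : ∀ {m n : ℕ}, m ≤ n → b m →ₗ[ℤ_[p]] b n
  /-- the maps `c^n_m` (on the `a`-component) -/
  ca : ∀ {m n : ℕ}, m ≤ n → a n →ₗ[ℤ_[p]] a m
  cb : ∀ {m n : ℕ}, m ≤ n → b n →ₗ[ℤ_[p]] b m
  ra_refl : ∀ (n : ℕ) (x : a n), ra (le_refl n) x = x
  rb_refl : ∀ (n : ℕ) (x : b n), rb (le_refl n) x = x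
  ca_refl : ∀ (n : ℕ) (x : a n), ca (le_refl n) x = x
  cb_refl : ∀ (n : ℕ) (x : b n), cb (le_refl n) x = x
  /-- (Γ-2): the `r`'s form an inductive system -/
  ra_trans : ∀ {k m n : ℕ} (h₁ : k ≤ m) (h₂ : m ≤ n) (x : a k),
    ra h₂ (ra h₁ x) = ra (h₁.trans h₂) x
  rb_trans : ∀ {k m n : ℕ} (h₁ : k ≤ m) (h₂ : m ≤ n) (x : b k),
    rb h₂ (rb h₁ x) = rb (h₁.trans h₂) x
  /-- (Γ-2): the `c`'s form a projective system -/
  ca_trans : ∀ {k m n : ℕ} (h₁ : k ≤ m) (h₂ : m ≤ n) (x : a n),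
    ca h₁ (ca h₂ x) = ca (h₁.trans h₂) x
  cb_trans : ∀ {k m n : ℕ} (h₁ : k ≤ m) (h₂ : m ≤ n) (x : b n),
    cb h₁ (cb h₂ x) = cb (h₁.trans h₂) x
  /-- (Γ-2): the transition maps are `Γ`-equivariant -/
  ra_comm : ∀ {m n : ℕ} (h : m ≤ n) (γ : Γ) (x : a m), ra h (ρa m γ x) = ρa n γ (ra h x)
  rb_comm : ∀ {m n : ℕ} (h : m ≤ n) (γ : Γ) (x : b m), rb h (ρb m γ x) = ρb n γ (rb h x)
  ca_comm : ∀ {m n : ℕ} (h : m ≤ n) (γ : Γ) (x : a n), ca h (ρa n γ x) = ρa m γ (ca h x)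
  cb_comm : ∀ {m n : ℕ} (h : m ≤ n) (γ : Γ) (x : b n), cb h (ρb n γ x) = ρb m γ (cb h x)
  /-- (Γ-3): `r^n_m ∘ c^n_m` is the norm map `Σ_{γ ∈ Γ^{p^m}/Γ^{p^n}} γ`, expressed via a
  complete set `T` of representatives of the cosets of `Γ^{p^n}` in `Γ^{p^m}` -/
  norm_a : ∀ {m n : ℕ} (h : m ≤ n), ∃ T : Finset Γ,
    (∀ γ ∈ T, γ ∈ powSubgroup Γ (p ^ m)) ∧
    (∀ γ ∈ powSubgroup Γ (p ^ m), ∃! s, s ∈ T ∧ s⁻¹ * γ ∈ powSubgroup Γ (p ^ n)) ∧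
    (∀ x : a n, ra h (ca h x) = ∑ γ ∈ T, ρa n γ x)
  norm_b : ∀ {m n : ℕ} (h : m ≤ n), ∃ T : Finset Γ,
    (∀ γ ∈ T, γ ∈ powSubgroup Γ (p ^ m)) ∧
    (∀ γ ∈ powSubgroup Γ (p ^ m), ∃! s, s ∈ T ∧ s⁻¹ * γ ∈ powSubgroup Γ (p ^ n)) ∧
    (∀ y : b n, rb h (cb h y) = ∑ γ ∈ T, ρb n γ y)
  /-- (Γ-3): `c^n_m ∘ r^n_m` is multiplication by `p^{n-m}` -/
  cr_a : ∀ {m n : ℕ} (h : m ≤ n) (x : a m), ca h (ra h x) = (p ^ (n - m)) • x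
  cr_b : ∀ {m n : ℕ} (h : m ≤ n) (y : b m), cb h (rb h y) = (p ^ (n - m)) • y
  /-- (Γ-4): the pairings `⟨,⟩_n` -/
  pair : ∀ n, a n →+ (b n →+ QpZp p)
  /-- (Γ-4): perfectness: `a n → Hom(b n, ℚ_p/ℤ_p)` is bijective -/
  perfect_a : ∀ n, Function.Bijective (pair n)
  /-- (Γ-4): perfectness: `b n → Hom(a n, ℚ_p/ℤ_p)` is bijective -/
  perfect_b : ∀ n, Function.Bijective (pair n).flip
  /-- (Γ-4): `Γ`-invariance of the pairings -/
  pair_inv : ∀ (n : ℕ) (γ : Γ) (x : a n) (y : b n), pair n (ρa n γ x) (ρb n γ y) = pair n x y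
  /-- (Γ-4): adjunction `⟨a_n, r(b_m)⟩_n = ⟨c(a_n), b_m⟩_m` -/
  pair_rc : ∀ {m n : ℕ} (h : m ≤ n) (x : a n) (y : b m), pair n x (rb h y) = pair m (ca h x) y
  /-- (Γ-4): adjunction `⟨r(a_m), b_n⟩_n = ⟨a_m, c(b_n)⟩_m` -/
  pair_cr : ∀ {m n : ℕ} (h : m ≤ n) (x : a m) (y : b n), pair n (ra h x) y = pair m x (cb h y)

attribute [instance] GammaSystem.instΓ GammaSystem.instA GammaSystem.instB
  GammaSystem.modA GammaSystem.modB

namespace GammaSystem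

variable {p d : ℕ} [Fact p.Prime] (S : GammaSystem p d)

/-- `a⁰_n`: the kernel of the canonical map `a n → lim→ a m` (elementwise: those `x` killed
by some transition map `r`). -/
def A0 (n : ℕ) : Submodule ℤ_[p] (S.a n) where
  carrier := {x | ∃ k, ∃ h : n ≤ k, S.ra h x = 0}
  zero_mem' := ⟨n, le_refl n, map_zero _⟩
  add_mem' := by
    rintro x y ⟨k₁, h₁, e₁⟩ ⟨k₂, h₂, e₂⟩
    refine ⟨max k₁ k₂, h₁.trans (le_max_left k₁ k₂), ?_⟩
    have ex : S.ra (h₁.trans (le_max_left k₁ k₂)) x = 0 := by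
      rw [← S.ra_trans h₁ (le_max_left k₁ k₂), e₁, map_zero]
    have ey : S.ra (h₁.trans (le_max_left k₁ k₂)) y = 0 := by
      have h' := S.ra_trans h₂ (le_max_right k₁ k₂) y
      rw [e₂, map_zero] at h'
      exact h'.symm
    rw [map_add, ex, ey, add_zero]
  smul_mem' := by
    rintro c x ⟨k, h, e⟩
    exact ⟨k, h, by rw [map_smul, e, smul_zero]⟩

/-- `b⁰_n`: the kernel of the canonical map `b n → lim→ b m`. -/
def B0 (n : ℕ) : Submodule ℤ_[p] (S.b n) where
  carrier := {y | ∃ k, ∃ h : n ≤ k, S.rb h y = 0}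
  zero_mem' := ⟨n, le_refl n, map_zero _⟩
  add_mem' := by
    rintro x y ⟨k₁, h₁, e₁⟩ ⟨k₂, h₂, e₂⟩
    refine ⟨max k₁ k₂, h₁.trans (le_max_left k₁ k₂), ?_⟩
    have ex : S.rb (h₁.trans (le_max_left k₁ k₂)) x = 0 := by
      rw [← S.rb_trans h₁ (le_max_left k₁ k₂), e₁, map_zero]
    have ey : S.rb (h₁.trans (le_max_left k₁ k₂)) y = 0 := by
      have h' := S.rb_trans h₂ (le_max_right k₁ k₂) y
      rw [e₂, map_zero] at h'
      exact h'.symm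
    rw [map_add, ex, ey, add_zero]
  smul_mem' := by
    rintro c x ⟨k, h, e⟩
    exact ⟨k, h, by rw [map_smul, e, smul_zero]⟩

/-- `a¹_n`: the annihilator of `b⁰_n` in `a n` under the pairing `⟨,⟩_n`. -/
def A1 (n : ℕ) : AddSubgroup (S.a n) where
  carrier := {x | ∀ y ∈ S.B0 n, S.pair n x y = 0}
  zero_mem' := fun y _ => by simp
  add_mem' := by
    intro x₁ x₂ h₁ h₂ y hy
    rw [map_add, AddMonoidHom.add_apply, h₁ y hy, h₂ y hy, add_zero]
  neg_mem' := by
    intro x hx y hy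
    rw [map_neg, AddMonoidHom.neg_apply, hx y hy, neg_zero]

/-- `b¹_n`: the annihilator of `a⁰_n` in `b n` under the pairing `⟨,⟩_n`. -/
def B1 (n : ℕ) : AddSubgroup (S.b n) where
  carrier := {y | ∀ x ∈ S.A0 n, S.pair n x y = 0}
  zero_mem' := fun x _ => by simp
  add_mem' := by
    intro y₁ y₂ h₁ h₂ x hx
    rw [map_add, h₁ x hx, h₂ x hx, add_zero]
  neg_mem' := by
    intro y hy x hx
    rw [map_neg, hy x hx, neg_zero]

/-- `a := lim← a_n`, the inverse limit along the maps `c^n_m`. -/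
def invLimA : AddSubgroup (∀ n, S.a n) where
  carrier := {x | ∀ (m n : ℕ) (h : m ≤ n), S.ca h (x n) = x m}
  zero_mem' := fun m n h => by simp
  add_mem' := by
    intro x y hx hy m n h
    simp only [Pi.add_apply, map_add, hx m n h, hy m n h]
  neg_mem' := by
    intro x hx m n h
    simp only [Pi.neg_apply, map_neg, hx m n h]

/-- `b := lim← b_n`, the inverse limit along the maps `c^n_m`. -/
def invLimB : AddSubgroup (∀ n, S.b n) where
  carrier := {y | ∀ (m n : ℕ) (h : m ≤ n), S.cb h (y n) = y m}
  zero_mem' := fun m n h => by simp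
  add_mem' := by
    intro x y hx hy m n h
    simp only [Pi.add_apply, map_add, hx m n h, hy m n h]
  neg_mem' := by
    intro x hx m n h
    simp only [Pi.neg_apply, map_neg, hx m n h]

end GammaSystem

namespace GammaSystem

variable {p d : ℕ} [Fact p.Prime] (S : GammaSystem p d)

lemma rb_maps_B0 {m n : ℕ} (h : m ≤ n) : S.B0 m ≤ (S.B0 n).comap (S.rb h) := by
  rintro y ⟨k, hk, e⟩
  refine ⟨max k n, le_max_right k n, ?_⟩
  have h1 : S.rb (le_max_right k n) (S.rb h y) = S.rb (h.trans (le_max_right k n)) y :=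
    S.rb_trans h (le_max_right k n) y
  have h2 : S.rb (le_max_left k n) (S.rb hk y) = S.rb (hk.trans (le_max_left k n)) y :=
    S.rb_trans hk (le_max_left k n) y
  rw [e, map_zero] at h2
  rw [h1]
  exact h2.symm

/-- The transition maps `b m ⧸ b⁰_m → b n ⧸ b⁰_n` induced by `r^n_m`. -/
def rbQ {m n : ℕ} (h : m ≤ n) : (S.b m ⧸ S.B0 m) →ₗ[ℤ_[p]] (S.b n ⧸ S.B0 n) :=
  Submodule.mapQ _ _ (S.rb h) (S.rb_maps_B0 h)

/-- `a¹ := lim← a¹_n`, realized as the subgroup of `lim← a_n` consisting of families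
lying in `a¹_n` at every level. -/
def invLimA1 : AddSubgroup (∀ n, S.a n) where
  carrier := {x | (∀ n, x n ∈ S.A1 n) ∧ ∀ (m n : ℕ) (h : m ≤ n), S.ca h (x n) = x m}
  zero_mem' := ⟨fun n => (S.A1 n).zero_mem, fun m n h => by simp⟩
  add_mem' := by
    rintro x y ⟨hx1, hx2⟩ ⟨hy1, hy2⟩
    exact ⟨fun n => (S.A1 n).add_mem (hx1 n) (hy1 n),
      fun m n h => by simp only [Pi.add_apply, map_add, hx2 m n h, hy2 m n h]⟩
  neg_mem' := by
    rintro x ⟨hx1, hx2⟩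
    exact ⟨fun n => (S.A1 n).neg_mem (hx1 n),
      fun m n h => by simp only [Pi.neg_apply, map_neg, hx2 m n h]⟩

end GammaSystem

/-- Compatible additive maps out of the components of a directed system of modules induce an
additive map out of the direct limit. -/
def directLimitLiftAddHom {R ι P : Type*} [Semiring R] [Preorder ι] [DecidableEq ι] {G : ι → Type*}
    [∀ i, AddCommMonoid (G i)] [∀ i, Module R (G i)] [AddCommMonoid P]
    (f : ∀ i j, i ≤ j → G i →ₗ[R] G j) (g : ∀ i, G i →+ P)
    (hg : ∀ i j hij x, g j (f i j hij x) = g i x) : Module.DirectLimit G f →+ P :=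
  AddCon.lift _ (DirectSum.toAddMonoid g) <|
    AddCon.addConGen_le.2 fun _ _ ⟨hij, x⟩ => by
      simpa [DirectSum.lof_eq_of] using (hg _ _ hij x).symm

@[simp]
lemma directLimitLiftAddHom_of {R ι P : Type*} [Semiring R] [Preorder ι] [DecidableEq ι]
    {G : ι → Type*} [∀ i, AddCommMonoid (G i)] [∀ i, Module R (G i)] [AddCommMonoid P]
    (f : ∀ i j, i ≤ j → G i →ₗ[R] G j) (g : ∀ i, G i →+ P)
    (hg : ∀ i j hij x, g j (f i j hij x) = g i x) (i : ι) (x : G i) :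
    directLimitLiftAddHom f g hg (Module.DirectLimit.of R ι G f i x) = g i x :=
  DirectSum.toAddMonoid_of g i x

namespace GammaSystem

variable {p d : ℕ} [Fact p.Prime] (S : GammaSystem p d)

lemma ca_mem_A1 {m n : ℕ} (h : m ≤ n) {x : S.a n} (hx : x ∈ S.A1 n) : S.ca h x ∈ S.A1 m :=
  fun y hy => (S.pair_rc h x y).symm.trans (hx _ (S.rb_maps_B0 h hy))

/-- The direct limit of the quotients `b n ⧸ b⁰_n`. -/
abbrev colimBModB0 : Type :=
  Module.DirectLimit (fun n => S.b n ⧸ S.B0 n) (fun _ _ h => S.rbQ h)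

/-- The canonical map `b n → lim→ (b m ⧸ b⁰_m)`. -/
def toColim (n : ℕ) : S.b n →+ S.colimBModB0 :=
  ((Module.DirectLimit.of ℤ_[p] ℕ (fun n => S.b n ⧸ S.B0 n) (fun _ _ h => S.rbQ h) n).comp
    (S.B0 n).mkQ).toAddMonoidHom

lemma toColim_rb {m n : ℕ} (h : m ≤ n) (y : S.b m) :
    S.toColim n (S.rb h y) = S.toColim m y :=
  Module.DirectLimit.of_f (f := fun _ _ h => S.rbQ h) (hij := h)
    (x := (Submodule.Quotient.mk y : S.b m ⧸ S.B0 m))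

lemma toColim_eq_zero {n : ℕ} {y : S.b n} (hy : y ∈ S.B0 n) : S.toColim n y = 0 := by
  obtain ⟨k, h, e⟩ := hy
  rw [← S.toColim_rb h, e, map_zero]

lemma exists_toColim_eq (z : S.colimBModB0) : ∃ n y, S.toColim n y = z := by
  obtain ⟨n, q, rfl⟩ := Module.DirectLimit.exists_of z
  obtain ⟨y, rfl⟩ := Submodule.Quotient.mk_surjective _ q
  exact ⟨n, y, rfl⟩

/-- The functional on `b n ⧸ b⁰_n` induced by pairing with an element of `a¹_n`. -/
def pairQ (n : ℕ) (x : S.a n) (hx : x ∈ S.A1 n) : (S.b n ⧸ S.B0 n) →+ QpZp p :=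
  QuotientAddGroup.lift (S.B0 n).toAddSubgroup (S.pair n x) hx

/-- The functional on `lim→ (b n ⧸ b⁰_n)` induced by pairing with an element of `a¹`. -/
def pairColim (x : S.invLimA1) : S.colimBModB0 →+ QpZp p :=
  directLimitLiftAddHom _ (fun n => S.pairQ n (x.1 n) (x.2.1 n)) fun m n h q => by
    obtain ⟨y, rfl⟩ := Submodule.Quotient.mk_surjective _ q
    have e : S.pair n (x.1 n) (S.rb h y) = S.pair m (x.1 m) y := by
      rw [S.pair_rc h, x.2.2 m n h]
    exact e

lemma pairColim_toColim (x : S.invLimA1) (n : ℕ) (y : S.b n) :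
    S.pairColim x (S.toColim n y) = S.pair n (x.1 n) y :=
  directLimitLiftAddHom_of (fun _ _ h => S.rbQ h)
    (fun n => S.pairQ n (x.1 n) (x.2.1 n)) _ n (Submodule.Quotient.mk y : S.b n ⧸ S.B0 n)

/-- The pairing `a¹ → Hom(lim→ (b n ⧸ b⁰_n), ℚ_p/ℤ_p)` as an additive map. -/
def pairColimHom : S.invLimA1 →+ (S.colimBModB0 →+ QpZp p) :=
  AddMonoidHom.mk' S.pairColim fun x x' => by
    ext z
    obtain ⟨n, y, rfl⟩ := S.exists_toColim_eq z
    simp [pairColim_toColim]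

lemma pairColimHom_injective : Function.Injective S.pairColimHom := by
  intro x x' h
  ext n
  refine (S.perfect_a n).1 (AddMonoidHom.ext fun y => ?_)
  rw [← S.pairColim_toColim, ← S.pairColim_toColim]
  exact DFunLike.congr_fun h (S.toColim n y)

lemma pairColimHom_surjective : Function.Surjective S.pairColimHom := by
  intro φ
  choose x hx using fun n => (S.perfect_a n).2 (φ.comp (S.toColim n))
  have hxy : ∀ n y, S.pair n (x n) y = φ (S.toColim n y) := fun n y =>
    DFunLike.congr_fun (hx n) y
  refine ⟨⟨x, fun n y hy => ?_, fun m n h => ?_⟩, ?_⟩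
  · rw [hxy, S.toColim_eq_zero hy, map_zero]
  · refine (S.perfect_a m).1 (AddMonoidHom.ext fun y => ?_)
    rw [← S.pair_rc h, hxy, hxy, S.toColim_rb h]
  · ext z
    obtain ⟨n, y, rfl⟩ := S.exists_toColim_eq z
    exact (S.pairColim_toColim _ n y).trans (hxy n y)

end GammaSystem

/-- For a `Γ`-system: (i) `r^n_m(b⁰_m) ⊆ b⁰_n` and `c^n_m(a¹_n) ⊆ a¹_m`, so the
quotients `b_n/b⁰_n` form an inductive system along the maps induced by `r^n_m` and the `a¹_n`
form a projective system along the maps induced by `c^n_m`; and (ii) the pairings `⟨,⟩_n`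
induce a group isomorphism `lim← a¹_n ≅ Hom(lim→ (b_n/b⁰_n), ℚ_p/ℤ_p)`, i.e.
`lim→ (b_n/b⁰_n) ≅ (a¹)^∨`. -/
theorem gammaSystem_colim_b_mod_B0_dual (p d : ℕ) [Fact p.Prime]
    (hp : p.Prime) (hodd : Odd p) (hd : 1 ≤ d) (S : GammaSystem p d) :
    (∀ (m n : ℕ) (h : m ≤ n), ∀ y ∈ S.B0 m, S.rb h y ∈ S.B0 n) ∧
    (∀ (m n : ℕ) (h : m ≤ n), ∀ x ∈ S.A1 n, S.ca h x ∈ S.A1 m) ∧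
    ∃ e : S.invLimA1 ≃+
        ((Module.DirectLimit (fun n => S.b n ⧸ S.B0 n) (fun _ _ h => S.rbQ h)) →+ QpZp p),
      ∀ (x : S.invLimA1) (n : ℕ) (y : S.b n),
        (e x) (Module.DirectLimit.of ℤ_[p] ℕ (fun n => S.b n ⧸ S.B0 n)
            (fun _ _ h => S.rbQ h) n (Submodule.Quotient.mk y))
          = S.pair n (x.1 n) y := by
  exact ⟨fun m n h y hy => S.rb_maps_B0 h hy, fun m n h x hx => S.ca_mem_A1 h hx,
    AddEquiv.ofBijective S.pairColimHom ⟨S.pairColimHom_injective, S.pairColimHom_surjective⟩,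
    S.pairColim_toColim⟩
end
end

section
/- Let {a_n, b_n, ⟨,⟩_n, r^n_m, c^n_m} be a collection of data satisfying axioms (Γ-1)–(Γ-4) of a Γ-system. Let a⁰_n = ker(a_n → lim→ a_m), b⁰_n = ker(b_n → lim→ b_m) (direct limits along r^n_m), let a¹_n ⊆ a_n be the annihilator of b⁰_n under ⟨,⟩_n, and let a'_n be the image of a¹_n in a_n/a⁰_n. Then every element (x_n)_n of a := lim← a_n (inverse limit along c^n_m) satisfies x_n ∈ a¹_n for all n, and the induced maps (x_n)_n ↦ (x_n mod a⁰_n)_n give a short exact sequence 0 → a⁰ → a → a' → 0, where a⁰ := lim← a⁰_n and a' := lim← a'_n (inverse limits along the maps induced by c^n_m); in particular, the natural map a → a' is surjective with kernel a⁰. -/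
open scoped BigOperators

noncomputable section

namespace GammaSystem

variable {p d : ℕ} [Fact p.Prime] (S : GammaSystem p d)

lemma ca_maps_A0 {m n : ℕ} (h : m ≤ n) : S.A0 n ≤ (S.A0 m).comap (S.ca h) := by
  rintro x ⟨k, hk, e⟩
  refine ⟨k, h.trans hk, ?_⟩
  obtain ⟨T, hT1, hT2, hT3⟩ := S.norm_a h
  have h1 : S.ra hk (S.ra h (S.ca h x)) = S.ra (h.trans hk) (S.ca h x) :=
    S.ra_trans h hk _
  rw [← h1, hT3 x, map_sum]
  refine Finset.sum_eq_zero fun γ _ => ?_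
  rw [S.ra_comm hk γ x, e]
  exact map_zero _

/-- The transition maps `a n ⧸ a⁰_n → a m ⧸ a⁰_m` induced by `c^n_m`. -/
def caQ {m n : ℕ} (h : m ≤ n) : (S.a n ⧸ S.A0 n) →ₗ[ℤ_[p]] (S.a m ⧸ S.A0 m) :=
  Submodule.mapQ _ _ (S.ca h) (S.ca_maps_A0 h)

/-- `a'_n`: the image of `a¹_n` in `a n ⧸ a⁰_n`. -/
def A' (n : ℕ) : AddSubgroup (S.a n ⧸ S.A0 n) :=
  (S.A1 n).map ((S.A0 n).mkQ.toAddMonoidHom)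

/-- `a' := lim← a'_n`, the inverse limit of the images `a'_n` along the maps induced
by `c^n_m`. -/
def invLimA' : AddSubgroup (∀ n, S.a n ⧸ S.A0 n) where
  carrier := {z | (∀ n, z n ∈ S.A' n) ∧ ∀ (m n : ℕ) (h : m ≤ n), S.caQ h (z n) = z m}
  zero_mem' := ⟨fun n => (S.A' n).zero_mem, fun m n h => by simp⟩
  add_mem' := by
    rintro x y ⟨hx1, hx2⟩ ⟨hy1, hy2⟩
    exact ⟨fun n => (S.A' n).add_mem (hx1 n) (hy1 n),
      fun m n h => by simp only [Pi.add_apply, map_add, hx2 m n h, hy2 m n h]⟩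
  neg_mem' := by
    rintro x ⟨hx1, hx2⟩
    exact ⟨fun n => (S.A' n).neg_mem (hx1 n),
      fun m n h => by simp only [Pi.neg_apply, map_neg, hx2 m n h]⟩

end GammaSystem

open CategoryTheory in
/-- An `ℕ`-indexed inverse system of nonempty finite subsets has a compatible sequence. -/
theorem exists_compatible_of_finite {X : ℕ → Type} (f : ∀ {m n : ℕ}, m ≤ n → X n → X m)
    (f_refl : ∀ (n : ℕ) (x : X n), f (le_refl n) x = x)
    (f_trans : ∀ {k m n : ℕ} (h₁ : k ≤ m) (h₂ : m ≤ n) (x : X n),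
      f h₁ (f h₂ x) = f (h₁.trans h₂) x)
    (F : ∀ n, Set (X n)) (hfin : ∀ n, (F n).Finite) (hne : ∀ n, (F n).Nonempty)
    (hmaps : ∀ {m n : ℕ} (h : m ≤ n), Set.MapsTo (f h) (F n) (F m)) :
    ∃ x : ∀ n, X n, (∀ n, x n ∈ F n) ∧ ∀ (m n : ℕ) (h : m ≤ n), f h (x n) = x m := by
  let G : ℕᵒᵖ ⥤ Type :=
    { obj := fun n => F n.unop
      map := fun g => TypeCat.ofHom fun x => ⟨f (leOfHom g.unop) x.1, hmaps _ x.2⟩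
      map_id := by
        intro n
        ext x
        exact f_refl _ _
      map_comp := by
        intro k m n g h
        ext x
        exact (f_trans _ _ _).symm }
  have : ∀ n, Finite (G.obj n) := fun n => (hfin n.unop).to_subtype
  have : ∀ n, Nonempty (G.obj n) := fun n => (hne n.unop).to_subtype
  obtain ⟨u, hu⟩ := nonempty_sections_of_finite_inverse_system G
  exact ⟨fun n => (u (Opposite.op n)).1, fun n => (u (Opposite.op n)).2,
    fun m n h => congrArg Subtype.val (hu (homOfLE h).op)⟩

namespace GammaSystem

variable {p d : ℕ} [Fact p.Prime] (S : GammaSystem p d)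

theorem mem_A1_of_mem_invLimA {x : ∀ n, S.a n} (hx : x ∈ S.invLimA) (n : ℕ) :
    x n ∈ S.A1 n := by
  rintro y ⟨k, h, e⟩
  rw [← hx n k h, ← S.pair_rc h, e, map_zero]

theorem mk_mem_invLimA' {x : ∀ n, S.a n} (hx : x ∈ S.invLimA) :
    (fun n => (Submodule.Quotient.mk (x n) : S.a n ⧸ S.A0 n)) ∈ S.invLimA' :=
  ⟨fun n => ⟨x n, S.mem_A1_of_mem_invLimA hx n, rfl⟩,
    fun m n h => congrArg Submodule.Quotient.mk (hx m n h)⟩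

theorem exists_mem_invLimA_mk_eq {z : ∀ n, S.a n ⧸ S.A0 n}
    (hz : ∀ (m n : ℕ) (h : m ≤ n), S.caQ h (z n) = z m) :
    ∃ x ∈ S.invLimA, ∀ n, (Submodule.Quotient.mk (x n) : S.a n ⧸ S.A0 n) = z n := by
  have := S.finA
  obtain ⟨x, hxz, hx⟩ := exists_compatible_of_finite (fun h => S.ca h) S.ca_refl S.ca_trans
    (fun n => {x | (Submodule.Quotient.mk x : S.a n ⧸ S.A0 n) = z n})
    (fun n => Set.toFinite _) (fun n => Submodule.Quotient.mk_surjective _ (z n))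
    (fun {m n} h x hx => by
      rw [Set.mem_ofPred_eq] at hx ⊢
      rw [← hz m n h, ← hx]
      rfl)
  exact ⟨x, hx, hxz⟩

end GammaSystem

/-- For a `Γ`-system: every element `(x_n)_n` of `a := lim← a_n` satisfies
`x_n ∈ a¹_n` for all `n`, and the induced maps `(x_n)_n ↦ (x_n mod a⁰_n)_n` give a short
exact sequence `0 → a⁰ → a → a' → 0`: the natural map `a → a'` is well-defined, surjective,
and has kernel `a⁰ = lim← a⁰_n`. -/
theorem gammaSystem_ses_invLimA (p d : ℕ) [Fact p.Prime]
    (hp : p.Prime) (hodd : Odd p) (hd : 1 ≤ d) (S : GammaSystem p d) :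
    (∀ x ∈ S.invLimA, ∀ n, x n ∈ S.A1 n) ∧
    (∀ x ∈ S.invLimA,
      (fun n => (Submodule.Quotient.mk (x n) : S.a n ⧸ S.A0 n)) ∈ S.invLimA') ∧
    (∀ z ∈ S.invLimA', ∃ x ∈ S.invLimA,
      ∀ n, (Submodule.Quotient.mk (x n) : S.a n ⧸ S.A0 n) = z n) ∧
    (∀ x ∈ S.invLimA,
      ((∀ n, (Submodule.Quotient.mk (x n) : S.a n ⧸ S.A0 n) = 0) ↔ ∀ n, x n ∈ S.A0 n)) := by
  exact ⟨fun _ hx => S.mem_A1_of_mem_invLimA hx, fun _ hx => S.mk_mem_invLimA' hx,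
    fun _ hz => S.exists_mem_invLimA_mk_eq hz.2,
    fun _ _ => forall_congr' fun n => Submodule.Quotient.mk_eq_zero (S.A0 n)⟩
end
end

section
/- Let {a_n, b_n, ⟨,⟩_n, r^n_m, c^n_m} be a collection of data satisfying axioms (Γ-1)–(Γ-4) of a Γ-system. Let a⁰_n = ker(a_n → lim→ a_m), b⁰_n = ker(b_n → lim→ b_m) (direct limits along r^n_m), let b¹_n ⊆ b_n be the annihilator of a⁰_n under ⟨,⟩_n, and let b'_n be the image of b¹_n in b_n/b⁰_n. Then every element (y_n)_n of b := lim← b_n (inverse limit along c^n_m) satisfies y_n ∈ b¹_n for all n, and the induced maps (y_n)_n ↦ (y_n mod b⁰_n)_n give a short exact sequence 0 → b⁰ → b → b' → 0, where b⁰ := lim← b⁰_n and b' := lim← b'_n (inverse limits along the maps induced by c^n_m); in particular, the natural map b → b' is surjective with kernel b⁰. -/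
open scoped BigOperators

noncomputable section

namespace GammaSystem

variable {p d : ℕ} [Fact p.Prime] (S : GammaSystem p d)

lemma cb_maps_B0 {m n : ℕ} (h : m ≤ n) : S.B0 n ≤ (S.B0 m).comap (S.cb h) := by
  rintro y ⟨k, hk, e⟩
  refine ⟨k, h.trans hk, ?_⟩
  obtain ⟨T, hT1, hT2, hT3⟩ := S.norm_b h
  have h1 : S.rb hk (S.rb h (S.cb h y)) = S.rb (h.trans hk) (S.cb h y) :=
    S.rb_trans h hk _
  rw [← h1, hT3 y, map_sum]
  refine Finset.sum_eq_zero fun γ _ => ?_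
  rw [S.rb_comm hk γ y, e]
  exact map_zero _

/-- The transition maps `b n ⧸ b⁰_n → b m ⧸ b⁰_m` induced by `c^n_m`. -/
def cbQ {m n : ℕ} (h : m ≤ n) : (S.b n ⧸ S.B0 n) →ₗ[ℤ_[p]] (S.b m ⧸ S.B0 m) :=
  Submodule.mapQ _ _ (S.cb h) (S.cb_maps_B0 h)

/-- `b'_n`: the image of `b¹_n` in `b n ⧸ b⁰_n`. -/
def B' (n : ℕ) : AddSubgroup (S.b n ⧸ S.B0 n) :=
  (S.B1 n).map ((S.B0 n).mkQ.toAddMonoidHom)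

/-- `b' := lim← b'_n`, the inverse limit of the images `b'_n` along the maps induced
by `c^n_m`. -/
def invLimB' : AddSubgroup (∀ n, S.b n ⧸ S.B0 n) where
  carrier := {z | (∀ n, z n ∈ S.B' n) ∧ ∀ (m n : ℕ) (h : m ≤ n), S.cbQ h (z n) = z m}
  zero_mem' := ⟨fun n => (S.B' n).zero_mem, fun m n h => by simp⟩
  add_mem' := by
    rintro x y ⟨hx1, hx2⟩ ⟨hy1, hy2⟩
    exact ⟨fun n => (S.B' n).add_mem (hx1 n) (hy1 n),
      fun m n h => by simp only [Pi.add_apply, map_add, hx2 m n h, hy2 m n h]⟩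
  neg_mem' := by
    rintro x ⟨hx1, hx2⟩
    exact ⟨fun n => (S.B' n).neg_mem (hx1 n),
      fun m n h => by simp only [Pi.neg_apply, map_neg, hx2 m n h]⟩

end GammaSystem

namespace GammaSystem

variable {p d : ℕ} [Fact p.Prime] (S : GammaSystem p d)

lemma ra_mem_A0 {m n : ℕ} (h : m ≤ n) {x : S.a m} (hx : x ∈ S.A0 m) : S.ra h x ∈ S.A0 n := by
  obtain ⟨k, hk, e⟩ := hx
  refine ⟨max k n, le_max_right k n, ?_⟩
  rw [S.ra_trans, ← S.ra_trans hk (le_max_left k n), e, map_zero]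

lemma cb_mem_B1 {m n : ℕ} (h : m ≤ n) {y : S.b n} (hy : y ∈ S.B1 n) : S.cb h y ∈ S.B1 m := by
  intro x hx
  rw [← S.pair_cr]
  exact hy _ (S.ra_mem_A0 h hx)

lemma mem_B1_of_mem_invLimB {y : ∀ n, S.b n} (hy : y ∈ S.invLimB) (n : ℕ) : y n ∈ S.B1 n := by
  rintro x ⟨k, hk, e⟩
  rw [← hy n k hk, ← S.pair_cr, e, map_zero, AddMonoidHom.zero_apply]

lemma mk_mem_invLimB' {y : ∀ n, S.b n} (hy : y ∈ S.invLimB) :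
    (fun n => (Submodule.Quotient.mk (y n) : S.b n ⧸ S.B0 n)) ∈ S.invLimB' := by
  refine ⟨fun n => ⟨y n, S.mem_B1_of_mem_invLimB hy n, rfl⟩, fun m n h => ?_⟩
  change Submodule.Quotient.mk (S.cb h (y n)) = _
  rw [hy m n h]

/-- The lifts to `b¹_n` of a compatible family in `b'` form an inverse system of nonempty
finite sets, which therefore has a compatible family of elements. -/
lemma exists_mem_invLimB_mk_eq {z : ∀ n, S.b n ⧸ S.B0 n} (hz : z ∈ S.invLimB') :
    ∃ y ∈ S.invLimB, ∀ n, (Submodule.Quotient.mk (y n) : S.b n ⧸ S.B0 n) = z n := by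
  let F : CategoryTheory.Functor ℕᵒᵖ Type :=
    { obj := fun n => {y : S.b n.unop // y ∈ S.B1 n.unop ∧
        (Submodule.Quotient.mk y : S.b n.unop ⧸ S.B0 n.unop) = z n.unop}
      map := fun f => TypeCat.ofHom fun y =>
        ⟨S.cb (CategoryTheory.leOfHom f.unop) y.1, S.cb_mem_B1 _ y.2.1,
          (congrArg (S.cbQ _) y.2.2).trans (hz.2 _ _ _)⟩
      map_id := fun n => by
        ext y
        exact S.cb_refl _ _
      map_comp := fun f g => by
        ext y
        exact (S.cb_trans _ _ _).symm }
  have hfin : ∀ n, Finite (F.obj n) := fun n =>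
    have := S.finB n.unop
    inferInstanceAs (Finite {y : S.b n.unop // _})
  have hne : ∀ n, Nonempty (F.obj n) := fun n => by
    obtain ⟨y, hy, e⟩ := hz.1 n.unop
    exact ⟨⟨y, hy, e⟩⟩
  obtain ⟨s, hs⟩ := nonempty_sections_of_finite_inverse_system F
  refine ⟨fun n => (s (.op n)).1, fun m n h => ?_, fun n => (s (.op n)).2.2⟩
  exact congrArg Subtype.val (hs (CategoryTheory.homOfLE h).op)

end GammaSystem

/-- For a `Γ`-system: every element `(y_n)_n` of `b := lim← b_n` satisfies
`y_n ∈ b¹_n` for all `n`, and the induced maps `(y_n)_n ↦ (y_n mod b⁰_n)_n` give a short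
exact sequence `0 → b⁰ → b → b' → 0`: the natural map `b → b'` is well-defined, surjective,
and has kernel `b⁰ = lim← b⁰_n`. -/
theorem gammaSystem_ses_invLimB (p d : ℕ) [Fact p.Prime]
    (hp : p.Prime) (hodd : Odd p) (hd : 1 ≤ d) (S : GammaSystem p d) :
    (∀ y ∈ S.invLimB, ∀ n, y n ∈ S.B1 n) ∧
    (∀ y ∈ S.invLimB,
      (fun n => (Submodule.Quotient.mk (y n) : S.b n ⧸ S.B0 n)) ∈ S.invLimB') ∧
    (∀ z ∈ S.invLimB', ∃ y ∈ S.invLimB,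
      ∀ n, (Submodule.Quotient.mk (y n) : S.b n ⧸ S.B0 n) = z n) ∧
    (∀ y ∈ S.invLimB,
      ((∀ n, (Submodule.Quotient.mk (y n) : S.b n ⧸ S.B0 n) = 0) ↔ ∀ n, y n ∈ S.B0 n)) := by
  exact ⟨fun y hy n => S.mem_B1_of_mem_invLimB hy n, fun y hy => S.mk_mem_invLimB' hy,
    fun z hz => S.exists_mem_invLimB_mk_eq hz,
    fun y _ => forall_congr' fun n => Submodule.Quotient.mk_eq_zero _⟩
end
end

section
/- Let {a_n, b_n, ⟨,⟩_n, r^n_m, c^n_m} be a collection of data satisfying axioms (Γ-1)–(Γ-4) of a Γ-system. Let b⁰_n = ker(b_n → lim→ b_m) (direct limit along r^n_m) and let a¹_n ⊆ a_n be the annihilator of b⁰_n under ⟨,⟩_n. Then the a¹_n are stable under the transition maps c^n_m, and the map lim← a¹_n → lim← a_n (inverse limits along c^n_m) induced by the inclusions a¹_n ⊆ a_n is an isomorphism; equivalently, every compatible family (x_n)_n ∈ lim← a_n satisfies x_n ∈ a¹_n for all n. -/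
open scoped BigOperators

noncomputable section

/-- For a `Γ`-system, the annihilators `a¹_n` of `b⁰_n` are stable under the
transition maps `c^n_m`, and the natural map `lim← a¹_n → lim← a_n` induced by the inclusions
`a¹_n ⊆ a_n` is an isomorphism; equivalently, every compatible family `(x_n)_n ∈ lim← a_n`
satisfies `x_n ∈ a¹_n` for all `n`. -/
theorem gammaSystem_invLimA1_eq_invLimA (p d : ℕ) [Fact p.Prime]
    (hp : p.Prime) (hodd : Odd p) (hd : 1 ≤ d) (S : GammaSystem p d) :
    (∀ (m n : ℕ) (h : m ≤ n), ∀ x ∈ S.A1 n, S.ca h x ∈ S.A1 m) ∧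
      S.invLimA1 = S.invLimA := by
  have rb_mem_B0 : ∀ (m n : ℕ) (h : m ≤ n), ∀ y ∈ S.B0 m, S.rb h y ∈ S.B0 n := by
    rintro m n h y ⟨k, hk, e⟩
    refine ⟨max n k, le_max_left n k, ?_⟩
    have e' := S.rb_trans hk (le_max_right n k) y
    rw [e, map_zero] at e'
    rw [S.rb_trans h (le_max_left n k), ← e']
  refine ⟨fun m n h x hx y hy => ?_, le_antisymm (fun x hx => hx.2) fun x hx => ⟨?_, hx⟩⟩
  · rw [← S.pair_rc h]
    exact hx _ (rb_mem_B0 m n h y hy)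
  · rintro n y ⟨k, h, e⟩
    rw [← hx n k h, ← S.pair_rc h, e, map_zero]
end
end
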